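/- Let q ≥ 2, 0 ≤ δ ≤ 1-1/q, 0 ≤ γ ≤ q-1, and let R be a real with 0 ≤ R < 1 - (1-δ+γ)·H_q(γ/(1-δ+γ)) - H_q(δ) + γ·log_q(q-1). Then for a sufficiently large constant l = O_{γ,δ,q}(1), a uniformly random code C ⊆ [q]^n of size q^{nR} fails to be l-list-decodable from γn insertions and δn deletions with probability at most q^{n(l+1)(R + H_q(δ) + (1-δ+γ)H_q(γ/(1-δ+γ)) - γ·log_q(q-1) - 1 + (1-δ+γ)/(l+1) + o(1))}, which tends to 0 as n → ∞. -/

import Mathlib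

open Filter Finset
open scoped Classical

/-- `Obtainable x w a b`: `w` can be obtained from `x` by at most `a` insertions and at
most `b` deletions. -/
def Obtainable {α : Type*} (x w : List α) (a b : ℕ) : Prop :=
  ∃ z : List α, z.Sublist x ∧ z.Sublist w ∧
    x.length ≤ z.length + b ∧ w.length ≤ z.length + a

/-- The `q`-ary entropy function. -/
noncomputable def Hq (q : ℕ) (x : ℝ) : ℝ :=
  x * Real.logb q ((q : ℝ) - 1) - x * Real.logb q x - (1 - x) * Real.logb q (1 - x)

/-- Number of length-`n` supersequences of `z`, by exponential weights. -/
lemma super_card (q : ℕ) (hq : 2 ≤ q) (x : ℝ) (hx0 : 0 < x) (hx1 : x ≤ 1) (n : ℕ) :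
    ∀ z : List (Fin q),
    ((Finset.univ.filter (fun X : Fin n → Fin q => z.Sublist (List.ofFn X))).card : ℝ)
      ≤ (1 / x + (q - 1)) ^ n * x ^ z.length := by
  have hq' : (2 : ℝ) ≤ q := by exact_mod_cast hq
  have hu : (0 : ℝ) ≤ 1 / x + (q - 1) := by
    have : 0 < 1 / x := by positivity
    linarith
  have h1x : 1 ≤ 1 / x := by rw [le_div_iff₀ hx0]; linarith
  induction n with
  | zero =>
    intro z
    cases z with
    | nil => simp
    | cons a z => simp; positivity
  | succ n ih =>
    intro z
    cases z with
    | nil =>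
      simp only [List.nil_sublist, Finset.filter_true, Finset.card_univ, Fintype.card_fun,
        Fintype.card_fin, List.length_nil, pow_zero, mul_one]
      push_cast
      exact pow_le_pow_left₀ (by linarith) (by linarith) _
    | cons a z =>
      have key : (Finset.univ.filter
          (fun X : Fin (n+1) → Fin q => (a :: z).Sublist (List.ofFn X))) ⊆
          ((Finset.univ.filter (fun X : Fin n → Fin q => z.Sublist (List.ofFn X))).image
            (fun X => (Fin.cons a X : Fin (n+1) → Fin q))) ∪
          (((Finset.univ.erase a) ×ˢ (Finset.univ.filter
            (fun X : Fin n → Fin q => (a :: z).Sublist (List.ofFn X)))).image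
            (fun p => (Fin.cons p.1 p.2 : Fin (n+1) → Fin q))) := by
        intro X hX
        simp only [Finset.mem_filter, Finset.mem_univ, true_and, List.ofFn_succ] at hX
        simp only [Finset.mem_union, Finset.mem_image, Finset.mem_filter, Finset.mem_univ,
          true_and, Finset.mem_product, Finset.mem_erase, and_true, Prod.exists]
        by_cases h : X 0 = a
        · left
          refine ⟨Fin.tail X, ?_, ?_⟩
          · rw [h] at hX
            exact List.cons_sublist_cons.1 hX
          · rw [← h]; exact Fin.cons_self_tail X
        · right
          refine ⟨X 0, Fin.tail X, ⟨h, ?_⟩, Fin.cons_self_tail X⟩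
          rcases List.cons_sublist_cons'.1 hX with h' | h'
          · exact h'
          · exact absurd h'.1.symm h
      have hc := (Finset.card_le_card key).trans ((Finset.card_union_le _ _).trans
        (add_le_add Finset.card_image_le Finset.card_image_le))
      rw [Finset.card_product, Finset.card_erase_of_mem (Finset.mem_univ _), Finset.card_univ,
        Fintype.card_fin] at hc
      have hc' : ((Finset.univ.filter
          (fun X : Fin (n+1) → Fin q => (a :: z).Sublist (List.ofFn X))).card : ℝ) ≤ _ :=
        Nat.cast_le.2 hc
      refine hc'.trans ?_
      push_cast [Nat.cast_sub (show 1 ≤ q by omega)]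
      have i1 := ih z
      have i2 := mul_le_mul_of_nonneg_left (ih (a :: z)) (show (0 : ℝ) ≤ q - 1 by linarith)
      refine (add_le_add i1 i2).trans (le_of_eq ?_)
      rw [List.length_cons]
      have hxx : 1 / x * x = 1 := by field_simp
      generalize (1 / x : ℝ) = w at hxx ⊢
      rw [pow_succ, pow_succ]
      linear_combination (-(w + ((q : ℝ) - 1)) ^ n * x ^ z.length) * hxx

lemma npow_eq_rpow (q : ℕ) (hq : 2 ≤ q) (p : ℝ) (hp : 0 ≤ p) (g : ℕ) (h : p = 0 → g = 0) :
    p ^ g = (q : ℝ) ^ ((g : ℝ) * Real.logb q p) := by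
  have hq' : (2 : ℝ) ≤ q := by exact_mod_cast hq
  rcases hp.eq_or_lt with h0 | h0
  · rw [h h0.symm]; simp
  · rw [mul_comm, Real.rpow_mul (by linarith), Real.rpow_logb (by linarith) (by linarith) h0,
      Real.rpow_natCast]

lemma choose_bound (q : ℕ) (hq : 2 ≤ q) (p : ℝ) (hp : 0 ≤ p) (hp1 : p < 1) (m g k : ℕ)
    (hm : m = g + k) (h : p = 0 → g = 0) :
    (m.choose k : ℝ) ≤ (q : ℝ) ^ (-(g * Real.logb q p) - k * Real.logb q (1 - p)) := by
  have hq' : (2 : ℝ) ≤ q := by exact_mod_cast hq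
  have h1 : p ^ g * (1 - p) ^ k * (m.choose k : ℝ) ≤ 1 := by
    have hsum := add_pow p (1 - p) m
    rw [add_sub_cancel, one_pow] at hsum
    refine le_trans ?_ hsum.symm.le
    have := Finset.single_le_sum (f := fun i => p ^ i * (1 - p) ^ (m - i) * (m.choose i : ℝ))
      (s := Finset.range (m+1)) (a := g)
      (fun i _ => by have : 0 ≤ 1 - p := by linarith
                     positivity) (by simp; omega)
    refine le_trans (le_of_eq ?_) this
    rw [show m - g = k by omega, ← Nat.choose_symm_of_eq_add hm]
  rw [npow_eq_rpow q hq p hp g h, npow_eq_rpow q hq (1 - p) (by linarith) k (by intro h; linarith),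
    ← Real.rpow_add (by linarith)] at h1
  rw [show -(g * Real.logb q p) - k * Real.logb q (1 - p) =
    -(g * Real.logb q p + k * Real.logb q (1 - p)) by ring, Real.rpow_neg (by linarith), ← one_div,
    le_div_iff₀ (by apply Real.rpow_pos_of_pos; linarith)]
  linarith

lemma super_bound (q : ℕ) (hq : 2 ≤ q) (δ : ℝ) (hδ0 : 0 ≤ δ) (hδ1 : δ ≤ 1 - 1 / q) (n dn : ℕ)
    (hn : 0 < n) (hd : (dn : ℝ) = δ * n) (z : List (Fin q)) (hz : z.length + dn = n) :
    ((Finset.univ.filter (fun X : Fin n → Fin q => z.Sublist (List.ofFn X))).card : ℝ)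
      ≤ (q : ℝ) ^ ((n : ℝ) * Hq q δ) := by
  have hq' : (2 : ℝ) ≤ q := by exact_mod_cast hq
  rcases hδ0.eq_or_lt with h0 | h0
  · subst h0
    have hd0 : dn = 0 := by simpa using hd
    have : Hq q 0 = 0 := by simp [Hq]
    rw [this, mul_zero, Real.rpow_zero]
    norm_cast
    rw [Finset.card_le_one]
    intro a ha b hb
    simp only [Finset.mem_filter, Finset.mem_univ, true_and] at ha hb
    have h1 := ha.eq_of_length (by simp; omega)
    have h2 := hb.eq_of_length (by simp; omega)
    exact List.ofFn_injective (h1.symm.trans h2)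
  · have h1q : 0 < 1 / (q : ℝ) := by positivity
    have hd1 : 0 < 1 - δ := by linarith
    have hqm : (0 : ℝ) < q - 1 := by linarith
    have hx0 : 0 < δ / ((1 - δ) * (q - 1)) := by positivity
    have hx1 : δ / ((1 - δ) * (q - 1)) ≤ 1 := by
      rw [div_le_one (by positivity)]
      have : δ * q ≤ (1 - 1 / q) * q := mul_le_mul_of_nonneg_right hδ1 (by linarith)
      rw [sub_mul, one_div_mul_cancel (by linarith)] at this
      nlinarith
    refine (super_card q hq _ hx0 hx1 n z).trans (le_of_eq ?_)
    have hk : (z.length : ℝ) = n - dn := by rw [← hz]; push_cast; ring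
    have e1 : 1 / (δ / ((1 - δ) * (q - 1))) + ((q : ℝ) - 1) = (q - 1) / δ := by
      field_simp; ring
    have hq1 : 1 < (q : ℝ) := by linarith
    rw [e1, npow_eq_rpow q hq _ (by positivity) n (by intro h; exact absurd h (by positivity)),
      npow_eq_rpow q hq _ hx0.le z.length (by intro h; exact absurd h hx0.ne'),
      ← Real.rpow_add (by linarith), Real.logb_div (by positivity) (by positivity),
      Real.logb_div (by positivity) (by positivity),
      Real.logb_mul (by positivity) (by positivity), hk, hd, Hq]
    congr 1
    ring

lemma obtain_bound (q : ℕ) (δ γ : ℝ) (hq : 2 ≤ q)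
    (hδ0 : 0 ≤ δ) (hδ1 : δ ≤ 1 - 1 / q) (hγ0 : 0 ≤ γ) (n dn gn mlen : ℕ) (hn : 0 < n)
    (hd : (dn : ℝ) = δ * n) (hg : (gn : ℝ) = γ * n)
    (hm : (mlen : ℝ) = (n : ℝ) * (1 - δ + γ)) (y : Fin mlen → Fin q) :
    ((Finset.univ.filter (fun X : Fin n → Fin q =>
      Obtainable (List.ofFn X) (List.ofFn y) gn dn)).card : ℝ) ≤
      (q : ℝ) ^ ((n : ℝ) * (Hq q δ + (1 - δ + γ) * Hq q (γ / (1 - δ + γ))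
                - γ * Real.logb q ((q : ℝ) - 1))) := by
  have hq' : (2 : ℝ) ≤ q := by exact_mod_cast hq
  have hn' : (0 : ℝ) < n := by exact_mod_cast hn
  have h1q : 0 < 1 / (q : ℝ) := by positivity
  have hd1 : 0 < 1 - δ := by linarith
  have hdn : dn ≤ n := by
    have : (dn : ℝ) ≤ n := by rw [hd]; nlinarith
    exact_mod_cast this
  obtain ⟨k, hk⟩ := Nat.exists_eq_add_of_le hdn
  have hkr : (k : ℝ) = (1 - δ) * n := by
    have : (n : ℝ) = dn + k := by exact_mod_cast hk
    linarith
  have hmk : mlen = gn + k := by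
    have : (mlen : ℝ) = gn + k := by rw [hm, hg, hkr]; ring
    exact_mod_cast this
  have key : (Finset.univ.filter (fun X : Fin n → Fin q =>
      Obtainable (List.ofFn X) (List.ofFn y) gn dn)) ⊆
      ((List.ofFn y).sublistsLen k).toFinset.biUnion
        (fun z => Finset.univ.filter (fun X : Fin n → Fin q => z.Sublist (List.ofFn X))) := by
    intro X hX
    simp only [Finset.mem_filter, Finset.mem_univ, true_and] at hX
    obtain ⟨z, h1, h2, h3, h4⟩ := hX
    simp only [Finset.mem_biUnion, List.mem_toFinset, List.mem_sublistsLen, Finset.mem_filter,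
      Finset.mem_univ, true_and]
    rw [List.length_ofFn] at h3 h4
    refine ⟨z.take k, ⟨(List.take_sublist _ _).trans h2, ?_⟩, (List.take_sublist _ _).trans h1⟩
    rw [List.length_take]; omega
  have hc : ((Finset.univ.filter (fun X : Fin n → Fin q =>
      Obtainable (List.ofFn X) (List.ofFn y) gn dn)).card : ℝ) ≤
      ((mlen.choose k : ℕ) : ℝ) * (q : ℝ) ^ ((n : ℝ) * Hq q δ) := by
    have h1 := (Finset.card_le_card key).trans Finset.card_biUnion_le
    refine (Nat.cast_le.2 h1).trans ?_
    push_cast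
    refine (Finset.sum_le_card_nsmul _ _ ((q : ℝ) ^ ((n : ℝ) * Hq q δ)) ?_).trans ?_
    · intro z hz
      simp only [List.mem_toFinset, List.mem_sublistsLen] at hz
      exact super_bound q hq δ hδ0 hδ1 n dn hn hd z (by omega)
    · rw [nsmul_eq_mul]
      refine mul_le_mul_of_nonneg_right ?_ (by positivity)
      have := List.toFinset_card_le ((List.ofFn y).sublistsLen k)
      rw [List.length_sublistsLen, List.length_ofFn] at this
      exact_mod_cast this
  refine hc.trans ?_
  have hs : 0 < 1 - δ + γ := by linarith
  have hp0 : 0 ≤ γ / (1 - δ + γ) := by positivity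
  have hp1 : γ / (1 - δ + γ) < 1 := by rw [div_lt_one hs]; linarith
  have hcb := choose_bound q hq (γ / (1 - δ + γ)) hp0 hp1 mlen gn k hmk (by
    intro h
    rcases div_eq_zero_iff.1 h with h | h
    · have : (gn : ℝ) = 0 := by rw [hg, h, zero_mul]
      exact_mod_cast this
    · linarith)
  refine (mul_le_mul_of_nonneg_right hcb (by positivity)).trans (le_of_eq ?_)
  rw [← Real.rpow_add (by linarith)]
  congr 1
  have e1 : (1 - δ + γ) * Hq q (γ / (1 - δ + γ)) = γ * Real.logb q ((q : ℝ) - 1)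
      - γ * Real.logb q (γ / (1 - δ + γ)) - (1 - δ) * Real.logb q (1 - γ / (1 - δ + γ)) := by
    rw [Hq]
    have a1 : (1 - δ + γ) * (γ / (1 - δ + γ)) = γ := by field_simp
    linear_combination (Real.logb q ((q : ℝ) - 1) - Real.logb q (γ / (1 - δ + γ))
      + Real.logb q (1 - γ / (1 - δ + γ))) * a1
  rw [e1, hg, hkr]
  ring

lemma union_bound {α β : Type*} [Fintype α] [Fintype β] (M l : ℕ) (P : α → β → Prop)
    (B : ℝ) (hα : 0 < Fintype.card α)
    (hB : ∀ y, ((Finset.univ.filter (fun x => P x y)).card : ℝ) ≤ B) :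
    ((Finset.univ.filter (fun X : Fin M → α => ∃ y : β,
      l + 1 ≤ (Finset.univ.filter (fun i : Fin M => P (X i) y)).card)).card : ℝ)
      / (Fintype.card α : ℝ) ^ M ≤
      Fintype.card β * ((M : ℝ) * (B / Fintype.card α)) ^ (l + 1) := by
  have hα' : (0 : ℝ) < Fintype.card α := by exact_mod_cast hα
  have key : (Finset.univ.filter (fun X : Fin M → α => ∃ y : β,
      l + 1 ≤ (Finset.univ.filter (fun i : Fin M => P (X i) y)).card)) ⊆
      (Finset.univ : Finset β).biUnion (fun y =>
        (Finset.powersetCard (l + 1) (Finset.univ : Finset (Fin M))).biUnion (fun T =>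
          Fintype.piFinset (fun i : Fin M =>
            if i ∈ T then Finset.univ.filter (fun x => P x y) else Finset.univ))) := by
    intro X hX
    simp only [Finset.mem_filter, Finset.mem_univ, true_and] at hX
    obtain ⟨y, hy⟩ := hX
    obtain ⟨T, hT, hTc⟩ := Finset.exists_subset_card_eq hy
    simp only [Finset.mem_biUnion, Finset.mem_univ, true_and, Finset.mem_powersetCard,
      Finset.subset_univ, Fintype.mem_piFinset]
    refine ⟨y, T, hTc, fun i => ?_⟩
    split_ifs with h
    · simpa using hT h
    · simp
  have hT : ∀ y : β, ∀ T ∈ Finset.powersetCard (l + 1) (Finset.univ : Finset (Fin M)),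
      ((Fintype.piFinset (fun i : Fin M =>
        if i ∈ T then Finset.univ.filter (fun x => P x y) else Finset.univ)).card : ℝ) ≤
        (B / Fintype.card α) ^ (l + 1) * (Fintype.card α : ℝ) ^ M := by
    intro y T hT
    rw [Finset.mem_powersetCard] at hT
    have hle : l + 1 ≤ M := by
      rw [← hT.2]; simpa using Finset.card_le_univ T
    rw [Fintype.card_piFinset]
    push_cast
    have : ∀ i : Fin M, (((if i ∈ T then Finset.univ.filter (fun x => P x y)
        else (Finset.univ : Finset α)).card : ℕ) : ℝ) =
        if i ∈ T then ((Finset.univ.filter (fun x => P x y)).card : ℝ) else Fintype.card α := by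
      intro i; split_ifs <;> simp
    rw [Finset.prod_congr rfl (fun i _ => this i), Finset.prod_ite, Finset.prod_const,
      Finset.prod_const]
    have c1 : (Finset.univ.filter (fun i => i ∈ T)).card = l + 1 := by simp [hT.2]
    have c2 : (Finset.univ.filter (fun i => i ∉ T)).card = M - (l + 1) := by
      have := Finset.card_compl T
      rw [hT.2, Fintype.card_fin] at this
      rw [← this]; congr 1; ext i; simp
    rw [c1, c2, div_pow, div_mul_eq_mul_div, mul_div_assoc, pow_sub₀ _ hα'.ne' hle,
      ← div_eq_mul_inv]
    exact mul_le_mul_of_nonneg_right (pow_le_pow_left₀ (by positivity) (hB y) _) (by positivity)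
  rw [div_le_iff₀ (by positivity)]
  refine (Nat.cast_le.2 ((Finset.card_le_card key).trans Finset.card_biUnion_le)).trans ?_
  push_cast
  refine (Finset.sum_le_card_nsmul _ _
    ((M : ℝ) ^ (l + 1) * ((B / Fintype.card α) ^ (l + 1) * (Fintype.card α : ℝ) ^ M)) ?_).trans ?_
  · intro y _
    have hB0 : 0 ≤ B := le_trans (by positivity) (hB y)
    refine (Nat.cast_le.2 Finset.card_biUnion_le).trans ?_
    push_cast
    refine (Finset.sum_le_card_nsmul _ _ _ (hT y)).trans ?_
    rw [nsmul_eq_mul, Finset.card_powersetCard, Finset.card_univ, Fintype.card_fin]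
    refine mul_le_mul_of_nonneg_right ?_ (by positivity)
    exact_mod_cast Nat.choose_le_pow M (l + 1)
  · rw [nsmul_eq_mul, Finset.card_univ, mul_pow]
    apply le_of_eq; ring

/-- For `0 ≤ R < 1 - (1-δ+γ)H_q(γ/(1-δ+γ)) - H_q(δ) + γ log_q(q-1)` there is a constant
list size `l` such that a uniformly random code `C ⊆ [q]^n` of size `q^{nR}` fails to be
`l`-list-decodable from `γn` insertions and `δn` deletions with probability at most
`q^{n(l+1)(R + H_q(δ) + (1-δ+γ)H_q(γ/(1-δ+γ)) - γ log_q(q-1) - 1 + (1-δ+γ)/(l+1) + o(1))}`,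
a bound which tends to `0` as `n → ∞`. -/
theorem random_code_list_decodable (q : ℕ) (δ γ R : ℝ) (hq : 2 ≤ q)
    (hδ0 : 0 ≤ δ) (hδ1 : δ ≤ 1 - 1 / q) (hγ0 : 0 ≤ γ) (hγ1 : γ ≤ (q : ℝ) - 1)
    (hR0 : 0 ≤ R)
    (hR1 : R < 1 - (1 - δ + γ) * Hq q (γ / (1 - δ + γ)) - Hq q δ
              + γ * Real.logb q ((q : ℝ) - 1)) :
    ∃ l : ℕ, ∃ E : ℕ → ℝ, Tendsto E atTop (nhds 0) ∧
      (∀ n M dn gn mlen : ℕ, 0 < n →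
        (M : ℝ) = (q : ℝ) ^ ((n : ℝ) * R) → (dn : ℝ) = δ * n → (gn : ℝ) = γ * n →
        (mlen : ℝ) = (n : ℝ) * (1 - δ + γ) →
        ((Finset.univ.filter (fun X : Fin M → Fin n → Fin q =>
            ∃ y : Fin mlen → Fin q,
              l + 1 ≤ (Finset.univ.filter (fun i : Fin M =>
                Obtainable (List.ofFn (X i)) (List.ofFn y) gn dn)).card)).card : ℝ)
          / ((q : ℝ) ^ n) ^ M
          ≤ (q : ℝ) ^ ((n : ℝ) * (l + 1) *
              (R + Hq q δ + (1 - δ + γ) * Hq q (γ / (1 - δ + γ))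
                - γ * Real.logb q ((q : ℝ) - 1) - 1 + (1 - δ + γ) / (l + 1) + E n))) ∧
      Tendsto (fun n : ℕ => (q : ℝ) ^ ((n : ℝ) * (l + 1) *
          (R + Hq q δ + (1 - δ + γ) * Hq q (γ / (1 - δ + γ))
            - γ * Real.logb q ((q : ℝ) - 1) - 1 + (1 - δ + γ) / (l + 1) + E n)))
        atTop (nhds 0) := by
  have hq' : (2 : ℝ) ≤ q := by exact_mod_cast hq
  have h1q : 0 < 1 / (q : ℝ) := by positivity
  have hs : 0 < 1 - δ + γ := by linarith
  set G : ℝ := R + Hq q δ + (1 - δ + γ) * Hq q (γ / (1 - δ + γ))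
                - γ * Real.logb q ((q : ℝ) - 1) - 1 with hG
  have hG0 : G < 0 := by rw [hG]; linarith
  obtain ⟨l, hl⟩ := exists_nat_gt ((1 - δ + γ) / (-G))
  have hneg : G + (1 - δ + γ) / ((l : ℝ) + 1) < 0 := by
    rw [div_lt_iff₀ (by linarith)] at hl
    have : (1 - δ + γ) / ((l : ℝ) + 1) < -G := by
      rw [div_lt_iff₀ (by positivity)]
      nlinarith
    linarith
  refine ⟨l, fun _ => 0, tendsto_const_nhds, ?_, ?_⟩
  · intro n M dn gn mlen hn hM hd hg hm
    have hob := obtain_bound q δ γ hq hδ0 hδ1 hγ0 n dn gn mlen hn hd hg hm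
    have hub := union_bound (α := Fin n → Fin q) (β := Fin mlen → Fin q) M l
      (fun x y => Obtainable (List.ofFn x) (List.ofFn y) gn dn) _
      (by rw [Fintype.card_fun, Fintype.card_fin, Fintype.card_fin]; positivity) hob
    simp only [Fintype.card_fun, Fintype.card_fin, Nat.cast_pow] at hub
    refine le_trans (le_of_eq ?_) (hub.trans (le_of_eq ?_))
    · congr!
    · have hq0 : (0 : ℝ) < q := by linarith
      rw [hM, ← Real.rpow_natCast (q : ℝ) n, ← Real.rpow_sub hq0, ← Real.rpow_add hq0,
        ← Real.rpow_natCast (q : ℝ) mlen, ← Real.rpow_natCast _ (l + 1), ← Real.rpow_mul hq0.le,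
        ← Real.rpow_add hq0, hm]
      congr 1
      rw [hG]
      push_cast
      field_simp
      ring
  · have hq0 : (0 : ℝ) < q := by linarith
    have h1 : Tendsto (fun n : ℕ => (n : ℝ) * (l + 1) *
        (G + (1 - δ + γ) / ((l : ℝ) + 1) + 0)) atTop atBot := by
      have : Tendsto (fun n : ℕ => (n : ℝ) * ((l + 1) *
        (G + (1 - δ + γ) / ((l : ℝ) + 1)))) atTop atBot :=
        tendsto_natCast_atTop_atTop.atTop_mul_const_of_neg
          (mul_neg_of_pos_of_neg (by positivity) hneg)
      refine this.congr (fun n => by ring)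
    exact (tendsto_rpow_atBot_of_base_gt_one (q : ℝ) (by linarith)).comp h1
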